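/- arXiv:2505.20234 — 3 statements merged into one kernel-verified Lean document; each statement's English description precedes it below -/
import Mathlib

section
/- Let A be a unital associative ℂ-algebra and N ≥ 3. Suppose K_{i,j} : ℂ → A (1 ≤ i,j ≤ N) is a family of elements satisfying the uncrossed reflection relation at every pair of parameters (u', v') with u' ≠ ±v', and suppose K_{N,1}(w) is invertible in A for every w ∈ ℂ. Define, for 2 ≤ a,b ≤ N−1 and w ∈ ℂ, the nested K-matrix K⁽²⁾_{a,b}(w) := K_{a,b}(w) − K_{a,1}(w)·K_{N,1}(w)⁻¹·K_{N,b}(w). Then for all u, v ∈ ℂ such that neither u−v nor u+v is an integer of absolute value at most N+2, the family K⁽²⁾ satisfies the uncrossed reflection relation of size N−2 at (u,v): for all 2 ≤ i,j,k,l ≤ N−1, [K⁽²⁾_{i,j}(u), K⁽²⁾_{k,l}(v)] = (u−v)⁻¹(K⁽²⁾_{k,j}(u)K⁽²⁾_{i,l}(v) − K⁽²⁾_{k,j}(v)K⁽²⁾_{i,l}(u)) + (u+v)⁻¹ Σ_{n=2}^{N−1}(δ_{j,k} K⁽²⁾_{i,n}(u)K⁽²⁾_{n,l}(v) − δ_{i,l}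 K⁽²⁾_{k,n}(v)K⁽²⁾_{n,j}(u)) − δ_{i,j}(u²−v²)⁻¹ Σ_{n=2}^{N−1}(K⁽²⁾_{k,n}(u)K⁽²⁾_{n,l}(v) − K⁽²⁾_{k,n}(v)K⁽²⁾_{n,l}(u)). -/
/-- The nested (second-level) uncrossed K-matrix:
`K⁽²⁾_{a,b}(w) = K_{a,b}(w) − K_{a,1}(w) K_{N,1}(w)⁻¹ K_{N,b}(w)`. -/
noncomputable def nestedK {A : Type*} [Ring A] (N : ℕ) (hN : 3 ≤ N)
    (K : ℂ → Fin N → Fin N → A) (Kinv : ℂ → A) (w : ℂ) (a b : Fin N) : A :=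
  K w a b - K w a ⟨0, by omega⟩ * Kinv w * K w ⟨N - 1, by omega⟩ b

set_option linter.unusedSimpArgs false

/-- Commutator with an inverse. -/
theorem comm_inv_aux {A : Type*} [Ring A] {t b β : A} (h1 : b * β = 1) (h2 : β * b = 1) :
    t * β - β * t = - (β * (t * b - b * t) * β) := by
  have e1 : β * (t * b) * β = β * t := by rw [mul_assoc, mul_assoc, h1, mul_one]
  have e2 : β * (b * t) * β = t * β := by rw [← mul_assoc β b t, h2, one_mul]
  rw [mul_sub, sub_mul, e1, e2]; abel

/-- The nested relation for abstract families, in a form with scalar Kronecker symbols. -/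
theorem nested_core {A : Type*} [Ring A] [Algebra ℂ A] {ι : Type*} (p q : ι) (hpq : p ≠ q)
    (K L P Q : ι → ι → A) (δ : ι → ι → ℂ) (hδ : ∀ i j, i ≠ j → δ i j = 0)
    (hδs : ∀ i j, δ i j = δ j i)
    (x y : ℂ) (hx : x ≠ 1)
    (H : ∀ i j k l, K i j * L k l - L k l * K i j
      = x • (K k j * L i l - L k j * K i l) + (y * δ j k) • P i l - (y * δ i l) • Q k j
        - (x * y * δ i j) • (P k l - Q k l))
    (H' : ∀ i j k l, L i j * K k l - K k l * L i j
      = (-x) • (L k j * K i l - K k j * L i l) + (y * δ j k) • Q i l - (y * δ i l) • P k j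
        + (x * y * δ i j) • (Q k l - P k l))
    (α β : A) (ha1 : K q p * α = 1) (ha2 : α * K q p = 1)
    (hb1 : L q p * β = 1) (hb2 : β * L q p = 1)
    (i j k l : ι) (hip : i ≠ p) (hiq : i ≠ q) (hjp : j ≠ p) (hjq : j ≠ q)
    (hkp : k ≠ p) (hkq : k ≠ q) (hlp : l ≠ p) (hlq : l ≠ q) :
    (K i j - K i p * α * K q j) * (L k l - L k p * β * L q l)
      - (L k l - L k p * β * L q l) * (K i j - K i p * α * K q j)
    = x • ((K k j - K k p * α * K q j) * (L i l - L i p * β * L q l)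
          - (L k j - L k p * β * L q j) * (K i l - K i p * α * K q l))
      + (y * δ j k) • (P i l - K i p * α * P q l - P i p * β * L q l
            + K i p * α * P q p * β * L q l)
      - (y * δ i l) • (Q k j - L k p * β * Q q j - Q k p * α * K q j
            + L k p * β * Q q p * α * K q j)
      - (x * y * δ i j) • ((P k l - K k p * α * P q l - P k p * β * L q l
            + K k p * α * P q p * β * L q l)
          - (Q k l - L k p * β * Q q l - Q k p * α * K q l
            + L k p * β * Q q p * α * K q l)) := by
  have ha1' : ∀ t, K q p * (α * t) = t := fun t => by rw [← mul_assoc, ha1, one_mul]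
  have ha2' : ∀ t, α * (K q p * t) = t := fun t => by rw [← mul_assoc, ha2, one_mul]
  have hb1' : ∀ t, L q p * (β * t) = t := fun t => by rw [← mul_assoc, hb1, one_mul]
  have hb2' : ∀ t, β * (L q p * t) = t := fun t => by rw [← mul_assoc, hb2, one_mul]
  -- the corner entries commute
  have hab : K q p * L q p = L q p * K q p := by
    have h := H q p q p
    rw [hδ p q hpq, hδ q p hpq.symm] at h
    have h2 : (1 - x) • (K q p * L q p - L q p * K q p) = 0 := by
      simp only [mul_zero, zero_smul, add_zero, sub_zero] at h
      rw [sub_smul, one_smul, sub_eq_zero]; exact h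
    rcases smul_eq_zero.1 h2 with h3 | h3
    · exact absurd (sub_eq_zero.1 h3).symm hx
    · exact sub_eq_zero.1 h3
  have haβ : K q p * β - β * K q p = 0 := by
    rw [comm_inv_aux hb1 hb2, hab]; simp
  -- commutation of the corner with the Schur complement
  have haT : ∀ k l, k ≠ p → l ≠ q →
      K q p * (L k l - L k p * β * L q l) - (L k l - L k p * β * L q l) * K q p = 0 := by
    intro k l hk hl
    have e1 := H q p k l
    have e2 := H q p k p
    have e3 := H q p q l
    rw [hδ p k hk.symm, hδ q l hl.symm, hδ q p hpq.symm] at e1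
    rw [hδ p k hk.symm, hδ q p hpq.symm] at e2
    rw [hδ p q hpq, hδ q l hl.symm, hδ q p hpq.symm] at e3
    linear_combination (norm := skip) e1 - e2 * (β * L q l) - (L k p * β) * e3
      - L k p * haβ * L q l + x • (L k p * haβ * L q l)
    simp only [sub_mul, mul_sub, add_mul, mul_add, mul_assoc, smul_mul_assoc, mul_smul_comm,
      smul_sub, smul_add, ha1, ha2, hb1, hb2, ha1', ha2', hb1', hb2', mul_one, one_mul, mul_zero,
      zero_mul, neg_mul, mul_neg]
    module
  have hαT : ∀ k l, k ≠ p → l ≠ q →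
      α * (L k l - L k p * β * L q l) - (L k l - L k p * β * L q l) * α = 0 := by
    intro k l hk hl
    have e := comm_inv_aux (t := L k l - L k p * β * L q l) ha1 ha2
    have e2 := haT k l hk hl
    rw [← neg_sub, e, ← neg_sub (K q p * _), e2]; simp
  have hrT : ∀ j k l, j ≠ q → k ≠ p → l ≠ q → l ≠ p →
      K q j * (L k l - L k p * β * L q l) - (L k l - L k p * β * L q l) * K q j
      = x • ((L k j - L k p * β * L q j) * (K q p * β * L q l - K q l))
        + (y * δ j k) • (P q l - P q p * β * L q l) := by
    intro j k l hj hk hl hl'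
    have e1 := H q j k l
    have e2 := H q j k p
    have e3 := H q j q l
    have e4 := H q j q p
    have e5 := comm_inv_aux (t := K q j) hb1 hb2
    simp only [hδ q l hl.symm, hδ q j hj.symm, hδ j q hj, hδ q p hpq.symm] at e1 e2 e3 e4
    linear_combination (norm := skip) e1 - e2 * (β * L q l) - (L k p * β) * e3
      - L k p * e5 * L q l + (L k p * β) * e4 * (β * L q l)
    simp only [sub_mul, mul_sub, add_mul, mul_add, mul_assoc, smul_mul_assoc, mul_smul_comm,
      smul_sub, smul_add, ha1, ha2, hb1, hb2, ha1', ha2', hb1', hb2', mul_one, one_mul, mul_zero,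
      zero_mul, neg_mul, mul_neg]
    module
  have hcT : ∀ i k l, i ≠ p → k ≠ p → l ≠ q →
      K i p * (L k l - L k p * β * L q l) - (L k l - L k p * β * L q l) * K i p
      = x • ((K k p - L k p * β * K q p) * (L i l - L i p * β * L q l))
        - (y * δ i l) • (Q k p - L k p * β * Q q p) := by
    intro i k l hi hk hl
    have e1 := H i p k l
    have e2 := H i p k p
    have e3 := H i p q l
    have e4 := H i p q p
    have e5 := comm_inv_aux (t := K i p) hb1 hb2
    simp only [hδ p k hk.symm, hδ i p hi, hδ p q hpq] at e1 e2 e3 e4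
    linear_combination (norm := skip) e1 - e2 * (β * L q l) - (L k p * β) * e3
      - L k p * e5 * L q l + (L k p * β) * e4 * (β * L q l)
    simp only [sub_mul, mul_sub, add_mul, mul_add, mul_assoc, smul_mul_assoc, mul_smul_comm,
      smul_sub, smul_add, ha1, ha2, hb1, hb2, ha1', ha2', hb1', hb2', mul_one, one_mul, mul_zero,
      zero_mul, neg_mul, mul_neg]
    module
  have hb := H' q p i j
  simp only [hδ p i hip.symm, hδ q j hjq.symm, hδ q p hpq.symm] at hb
  have hKβ := comm_inv_aux (t := K i j) hb1 hb2
  have h1 := H q p i j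
  simp only [hδ p i hip.symm, hδ q j hjq.symm, hδ q p hpq.symm] at h1
  have hrd := H q j i p
  simp only [hδ q p hpq.symm, hδ q j hjq.symm, hδs j i] at hrd
  have hcs := H i p q j
  simp only [hδ p q hpq, hδ i p hip] at hcs
  have r1 := H i j k l
  have r2 := H i j k p
  simp only [hδ i p hip] at r2
  have r3 := H i j q l
  simp only [hδ j q hjq] at r3
  linear_combination (norm := skip) r1 - r2 * (β * L q l) - (L k p * β) * r3
    - L k p * hKβ * L q l - (L k p * β) * hb * (β * L q l)
    - x • ((L k p * β) * hrd * (β * L q l))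
    - x • ((L k p * β) * hcs * (β * L q l))
    - (x * x) • ((L k p * β) * h1 * (β * L q l))
    + (x * x) • ((L k p * β) * hb * (β * L q l))
    - (K i p * α) * hrT j k l hjq hkp hlq hlp
    - hcT i k l hip hkp hlq * (α * K q j)
    - K i p * hαT k l hkp hlq * K q j
    - x • (K i p * hαT k j hkp hjq * (K q p * β * L q l - K q l))
    + x • ((K k p - L k p * β * K q p) * hαT i l hip hlq * K q j)
    + x • ((K k p * α - L k p * β) * hrT j i l hjq hip hlq hlp)
    - x • (hcT i k j hip hkp hjq * (β * L q l - α * K q l))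
    - (x * x) • ((K k p * α - L k p * β) * haT i j hip hjq * (β * L q l - α * K q l))
  simp only [sub_mul, mul_sub, add_mul, mul_add, mul_assoc, smul_mul_assoc, mul_smul_comm,
    smul_sub, smul_add, ha1, ha2, hb1, hb2, ha1', ha2', hb1', hb2', mul_one, one_mul, mul_zero,
    zero_mul, neg_mul, mul_neg, hδs j i]
  module

/-- Sums of products of Schur complements over the inner indices. -/
theorem sum_schur {A : Type*} [Ring A] {ι : Type*} [Fintype ι] [DecidableEq ι] (p q : ι)
    (K L : ι → ι → A) (α β : A) (ha2 : α * K q p = 1) (hb1 : L q p * β = 1) (i l : ι) :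
    ∑ n ∈ Finset.univ.filter (fun n : ι => n ≠ p ∧ n ≠ q),
      (K i n - K i p * α * K q n) * (L n l - L n p * β * L q l)
    = (∑ n, K i n * L n l) - K i p * α * (∑ n, K q n * L n l)
      - (∑ n, K i n * L n p) * β * L q l
      + K i p * α * (∑ n, K q n * L n p) * β * L q l := by
  rw [Finset.sum_filter_of_ne]
  · simp only [Finset.mul_sum, Finset.sum_mul]
    rw [← Finset.sum_sub_distrib, ← Finset.sum_sub_distrib, ← Finset.sum_add_distrib]
    refine Finset.sum_congr rfl fun n _ => ?_
    noncomm_ring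
  · intro n _ hn
    constructor
    · rintro rfl
      apply hn
      rw [mul_assoc (K i n), ha2]; simp
    · rintro rfl
      apply hn
      rw [hb1]; simp

/-- First nesting step of Theorem 4.2: the nested K-matrix of an uncrossed
reflection-algebra representation satisfies the uncrossed reflection relation of
size N−2. -/
theorem stmt_7 {A : Type*} [Ring A] [Algebra ℂ A]
    (N : ℕ) (hN : 3 ≤ N)
    (K : ℂ → Fin N → Fin N → A)
    (hrel : ∀ u' v' : ℂ, u' ≠ v' → u' ≠ -v' → ∀ i j k l : Fin N,
      K u' i j * K v' k l - K v' k l * K u' i j =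
        (u' - v')⁻¹ • (K u' k j * K v' i l - K v' k j * K u' i l)
        + (u' + v')⁻¹ • (∑ n, ((if j = k then K u' i n * K v' n l else 0)
            - (if i = l then K v' k n * K u' n j else 0)))
        - (if i = j then
            (u' ^ 2 - v' ^ 2)⁻¹ • (∑ n, (K u' k n * K v' n l - K v' k n * K u' n l))
          else 0))
    (Kinv : ℂ → A)
    (hKinv : ∀ w : ℂ, Kinv w * K w ⟨N - 1, by omega⟩ ⟨0, by omega⟩ = 1 ∧
      K w ⟨N - 1, by omega⟩ ⟨0, by omega⟩ * Kinv w = 1)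
    (u v : ℂ)
    (huv : ∀ m : ℤ, |m| ≤ (N : ℤ) + 2 → u - v ≠ (m : ℂ) ∧ u + v ≠ (m : ℂ)) :
    ∀ i j k l : Fin N,
      i ≠ (⟨0, by omega⟩ : Fin N) → i ≠ (⟨N - 1, by omega⟩ : Fin N) →
      j ≠ (⟨0, by omega⟩ : Fin N) → j ≠ (⟨N - 1, by omega⟩ : Fin N) →
      k ≠ (⟨0, by omega⟩ : Fin N) → k ≠ (⟨N - 1, by omega⟩ : Fin N) →
      l ≠ (⟨0, by omega⟩ : Fin N) → l ≠ (⟨N - 1, by omega⟩ : Fin N) →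
      nestedK N hN K Kinv u i j * nestedK N hN K Kinv v k l
          - nestedK N hN K Kinv v k l * nestedK N hN K Kinv u i j =
        (u - v)⁻¹ • (nestedK N hN K Kinv u k j * nestedK N hN K Kinv v i l
            - nestedK N hN K Kinv v k j * nestedK N hN K Kinv u i l)
        + (u + v)⁻¹ • (∑ n ∈ Finset.univ.filter
              (fun n : Fin N => n ≠ (⟨0, by omega⟩ : Fin N) ∧ n ≠ (⟨N - 1, by omega⟩ : Fin N)),
            ((if j = k then nestedK N hN K Kinv u i n * nestedK N hN K Kinv v n l else 0)
              - (if i = l then nestedK N hN K Kinv v k n * nestedK N hN K Kinv u n j else 0)))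
        - (if i = j then
            (u ^ 2 - v ^ 2)⁻¹ • (∑ n ∈ Finset.univ.filter
                (fun n : Fin N => n ≠ (⟨0, by omega⟩ : Fin N) ∧ n ≠ (⟨N - 1, by omega⟩ : Fin N)),
              (nestedK N hN K Kinv u k n * nestedK N hN K Kinv v n l
                - nestedK N hN K Kinv v k n * nestedK N hN K Kinv u n l))
          else 0) := by
  intro i j k l hip hiq hjp hjq hkp hkq hlp hlq
  have h0 := huv 0 (by simp; omega)
  have h1 := huv 1 (by simp; omega)
  simp only [Int.cast_zero, Int.cast_one] at h0 h1
  have hne : u ≠ v := fun h => h0.1 (sub_eq_zero.2 h)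
  have hne' : u ≠ -v := fun h => h0.2 (by rw [h]; ring)
  have hne2 : v ≠ -u := fun h => h0.2 (by rw [h]; ring)
  have hz : (u ^ 2 - v ^ 2)⁻¹ = (u - v)⁻¹ * (u + v)⁻¹ := by
    rw [← mul_inv]; congr 1; ring
  have hz' : (v ^ 2 - u ^ 2)⁻¹ = -((u - v)⁻¹ * (u + v)⁻¹) := by
    rw [← mul_inv, ← inv_neg]; congr 1; ring
  have hxx : (v - u)⁻¹ = -(u - v)⁻¹ := by rw [← inv_neg]; congr 1; ring
  have hpq : (⟨0, by omega⟩ : Fin N) ≠ ⟨N - 1, by omega⟩ := by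
    intro h; have := congrArg Fin.val h; simp at this; omega
  have core := nested_core (A := A) (⟨0, by omega⟩ : Fin N) ⟨N - 1, by omega⟩ hpq (K u) (K v)
    (fun i l => ∑ n, K u i n * K v n l) (fun k j => ∑ n, K v k n * K u n j)
    (fun i j => if i = j then 1 else 0) (fun i j h => if_neg h)
    (fun i j => by simp only [eq_comm])
    (u - v)⁻¹ (u + v)⁻¹ (fun h => h1.1 (inv_eq_one.1 h))
    (by
      intro i j k l
      rw [hrel u v hne hne' i j k l, hz]
      split_ifs <;> simp only [Finset.sum_sub_distrib, Finset.sum_const_zero] <;> module)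
    (by
      intro i j k l
      rw [hrel v u hne.symm hne2 i j k l, hz', hxx, add_comm v u]
      split_ifs <;> simp only [Finset.sum_sub_distrib, Finset.sum_const_zero] <;> module)
    (Kinv u) (Kinv v) (hKinv u).2 (hKinv u).1 (hKinv v).2 (hKinv v).1
    i j k l hip hiq hjp hjq hkp hkq hlp hlq
  have s1 := fun i l => sum_schur (⟨0, by omega⟩ : Fin N) ⟨N - 1, by omega⟩ (K u) (K v)
    (Kinv u) (Kinv v) (hKinv u).1 (hKinv v).2 i l
  have s2 := fun i l => sum_schur (⟨0, by omega⟩ : Fin N) ⟨N - 1, by omega⟩ (K v) (K u)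
    (Kinv v) (Kinv u) (hKinv v).1 (hKinv u).2 i l
  simp only [← s1, ← s2] at core
  simp only [nestedK]
  rw [core, hz]
  split_ifs <;> simp only [Finset.sum_sub_distrib, Finset.sum_const_zero] <;>
    module
end

section
/- Let A be a unital associative ℂ-algebra and N ≥ 2. Suppose K_{i,j} : ℂ → A (1 ≤ i,j ≤ N) is a family of elements satisfying the crossed reflection relation at every pair of parameters (u', v') with u' ≠ ±v', suppose the N×N matrix K(w) = (K_{i,j}(w)) is invertible in the matrix ring M_N(A) for every w ∈ ℂ, and suppose K_{1,1}(w) is invertible in A for every w ∈ ℂ. Define, for 2 ≤ a,b ≤ N and w ∈ ℂ, the shifted nested K-matrix K̃_{a,b}(w) := K_{a,b}(w − 1/2) − K_{a,1}(w − 1/2)·K_{1,1}(w − 1/2)⁻¹·K_{1,b}(w − 1/2). Then for all u, v ∈ ℂ such that neither 2(u−v) nor 2(u+v) is an integer of absolute value at most 2N+4, the family K̃ satisfies the crossed reflection relation of size N−1 at (u,v): for all 2 ≤ i,j,k,l ≤ N, [K̃_{i,j}(u), K̃_{k,l}(v)] = (u−v)⁻¹(K̃_{k,j}(u)K̃_{i,l}(v)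 − K̃_{k,j}(v)K̃_{i,l}(u)) − (u+v)⁻¹(K̃_{i,k}(u)K̃_{j,l}(v) − K̃_{k,i}(v)K̃_{l,j}(u)) + (u²−v²)⁻¹(K̃_{k,i}(u)K̃_{j,l}(v) − K̃_{k,i}(v)K̃_{j,l}(u)). -/
/-- The shifted nested crossed K-matrix:
`K̃_{a,b}(w) = K_{a,b}(w−1/2) − K_{a,1}(w−1/2) K_{1,1}(w−1/2)⁻¹ K_{1,b}(w−1/2)`. -/
noncomputable def shiftedNestedK {A : Type*} [Ring A] (N : ℕ) (hN : 2 ≤ N)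
    (K : ℂ → Fin N → Fin N → A) (Kinv : ℂ → A) (w : ℂ) (a b : Fin N) : A :=
  K (w - 1 / 2) a b -
    K (w - 1 / 2) a ⟨0, by omega⟩ * Kinv (w - 1 / 2) * K (w - 1 / 2) ⟨0, by omega⟩ b

set_option linter.unusedSectionVars false

namespace CrossedRefl

variable {A : Type*} [Ring A] [Algebra ℂ A] {I : Type*} [Fintype I] [DecidableEq I]

/-- The crossed reflection relation with scalar parameters `a = (u-v)⁻¹`, `b = (u+v)⁻¹`. -/
def Rel (X Y : Matrix I I A) (a b : ℂ) : Prop :=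
  ∀ i j k l : I, X i j * Y k l - Y k l * X i j =
    a • (X k j * Y i l - Y k j * X i l) - b • (X i k * Y j l - Y k i * X l j)
      + (a * b) • (X k i * Y j l - Y k i * X j l)

/-- `X` acting on the first tensor factor. -/
def K1 (X : Matrix I I A) : Matrix (I × I) (I × I) A :=
  Matrix.of fun p q => if p.2 = q.2 then X p.1 q.1 else 0

/-- `X` acting on the second tensor factor. -/
def K2 (X : Matrix I I A) : Matrix (I × I) (I × I) A :=
  Matrix.of fun p q => if p.1 = q.1 then X p.2 q.2 else 0

variable (A I) in
/-- The permutation matrix. -/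
def PP : Matrix (I × I) (I × I) A :=
  Matrix.of fun p q => if p.1 = q.2 then (if p.2 = q.1 then 1 else 0) else 0

variable (A I) in
/-- The partially transposed permutation matrix. -/
def QQ : Matrix (I × I) (I × I) A :=
  Matrix.of fun p q => if p.1 = p.2 then (if q.1 = q.2 then 1 else 0) else 0

lemma K1_mul (X Y : Matrix I I A) : K1 X * K1 Y = K1 (X * Y) := by
  ext ⟨i, k⟩ ⟨j, l⟩
  by_cases h : k = l <;> simp [K1, Matrix.mul_apply, Fintype.sum_prod_type, h]

lemma K2_mul (X Y : Matrix I I A) : K2 X * K2 Y = K2 (X * Y) := by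
  ext ⟨i, k⟩ ⟨j, l⟩
  by_cases h : i = j <;> simp [K2, Matrix.mul_apply, Fintype.sum_prod_type, h]

lemma K1_one : K1 (1 : Matrix I I A) = 1 := by
  ext ⟨i, k⟩ ⟨j, l⟩
  by_cases h : k = l <;> by_cases h' : i = j <;> simp [K1, Matrix.one_apply, h, h']

lemma K2_one : K2 (1 : Matrix I I A) = 1 := by
  ext ⟨i, k⟩ ⟨j, l⟩
  by_cases h : k = l <;> by_cases h' : i = j <;> simp [K2, Matrix.one_apply, h, h']

lemma PP_mul (M : Matrix (I × I) (I × I) A) (i k : I) (q : I × I) :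
    (PP A I * M) (i, k) q = M (k, i) q := by
  simp [PP, Matrix.mul_apply, Fintype.sum_prod_type]

lemma mul_PP (M : Matrix (I × I) (I × I) A) (j l : I) (p : I × I) :
    (M * PP A I) p (j, l) = M p (l, j) := by
  simp [PP, Matrix.mul_apply, Fintype.sum_prod_type]

lemma PP_sq : PP A I * PP A I = 1 := by
  ext ⟨i, k⟩ ⟨j, l⟩
  rw [PP_mul]
  by_cases h : k = l <;> by_cases h' : i = j <;> simp [PP, Matrix.one_apply, h, h']

lemma QQ_sq : QQ A I * QQ A I = (Fintype.card I : ℂ) • QQ A I := by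
  ext ⟨i, k⟩ ⟨j, l⟩
  by_cases h : i = k <;> by_cases h' : j = l <;>
    simp [QQ, Matrix.mul_apply, Fintype.sum_prod_type, h, h', Algebra.smul_def]

lemma e12 (X Y : Matrix I I A) (i j k l : I) :
    (K1 X * K2 Y) (i, k) (j, l) = X i j * Y k l := by
  simp [K1, K2, Matrix.mul_apply, Fintype.sum_prod_type]

lemma e21 (X Y : Matrix I I A) (i j k l : I) :
    (K2 Y * K1 X) (i, k) (j, l) = Y k l * X i j := by
  simp [K1, K2, Matrix.mul_apply, Fintype.sum_prod_type]

lemma e1Q (X : Matrix I I A) (i k : I) (q : I × I) :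
    (K1 X * QQ A I) (i, k) q = if q.1 = q.2 then X i k else 0 := by
  simp [K1, QQ, Matrix.mul_apply, Fintype.sum_prod_type]

lemma e2Q (X : Matrix I I A) (i k : I) (q : I × I) :
    (K2 X * QQ A I) (i, k) q = if q.1 = q.2 then X k i else 0 := by
  simp [K2, QQ, Matrix.mul_apply, Fintype.sum_prod_type]

lemma e1Q2 (X Y : Matrix I I A) (i j k l : I) :
    (K1 X * QQ A I * K2 Y) (i, k) (j, l) = X i k * Y j l := by
  rw [Matrix.mul_apply]
  simp only [e1Q]
  simp [K2, Fintype.sum_prod_type]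

lemma e2Q1 (X Y : Matrix I I A) (i j k l : I) :
    (K2 Y * QQ A I * K1 X) (i, k) (j, l) = Y k i * X l j := by
  rw [Matrix.mul_apply]
  simp only [e2Q]
  simp [K1, Fintype.sum_prod_type]

lemma rel_iff (X Y : Matrix I I A) (a b : ℂ) :
    Rel X Y a b ↔ (1 - a • PP A I) * K1 X * (1 + b • QQ A I) * K2 Y
      = K2 Y * (1 + b • QQ A I) * K1 X * (1 - a • PP A I) := by
  have hl : (1 - a • PP A I) * K1 X * (1 + b • QQ A I) * K2 Y
      = K1 X * K2 Y - a • (PP A I * (K1 X * K2 Y)) + b • (K1 X * QQ A I * K2 Y)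
        - (a * b) • (PP A I * (K1 X * QQ A I * K2 Y)) := by
    simp only [sub_mul, mul_add, add_mul, one_mul, mul_one, smul_mul_assoc, mul_smul_comm,
      smul_sub, mul_assoc]
    module
  have hr : K2 Y * (1 + b • QQ A I) * K1 X * (1 - a • PP A I)
      = K2 Y * K1 X - a • ((K2 Y * K1 X) * PP A I) + b • (K2 Y * QQ A I * K1 X)
        - (a * b) • ((K2 Y * QQ A I * K1 X) * PP A I) := by
    simp only [mul_sub, mul_add, add_mul, one_mul, mul_one, smul_mul_assoc, mul_smul_comm,
      smul_add, mul_smul, mul_assoc]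
    abel
  rw [hl, hr, ← Matrix.ext_iff]
  simp only [Prod.forall, Matrix.sub_apply, Matrix.add_apply, Matrix.smul_apply, PP_mul, mul_PP,
    e12, e21, e1Q2, e2Q1]
  have key : ∀ i j k l : I, (X i j * Y k l - Y k l * X i j =
      a • (X k j * Y i l - Y k j * X i l) - b • (X i k * Y j l - Y k i * X l j)
      + (a * b) • (X k i * Y j l - Y k i * X j l)) ↔
      (X i j * Y k l - a • (X k j * Y i l) + b • (X i k * Y j l) - (a * b) • (X k i * Y j l)
      = Y k l * X i j - a • (Y k j * X i l) + b • (Y k i * X l j)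
        - (a * b) • (Y k i * X j l)) := by
    intro i j k l
    rw [← sub_eq_zero, ← sub_eq_zero (b := Y k l * X i j - _ + _ - _)]
    simp only [smul_sub]
    constructor <;> intro h <;> rw [← h] <;> abel
  constructor
  · intro h i k j l
    exact (key i j k l).1 (h i j k l)
  · intro h i j k l
    exact (key i j k l).2 (h i k j l)

lemma rel_inv (X Y X' Y' : Matrix I I A) (a b : ℂ) (h : Rel X Y a b)
    (hX : X * X' = 1) (hX' : X' * X = 1) (hY : Y * Y' = 1) (hY' : Y' * Y = 1)
    (ha : 1 - a ^ 2 ≠ 0) (hb : 1 + b * Fintype.card I ≠ 0) :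
    Rel X' Y' (-a) (-(b / (1 + b * Fintype.card I))) := by
  rw [rel_iff] at h ⊢
  set c : ℂ := -(b / (1 + b * Fintype.card I)) with hc
  have hPP : ∀ s : ℂ, (1 - s • PP A I) * (1 - (-s) • PP A I) = (1 - s ^ 2) • 1 := by
    intro s
    simp only [sub_mul, mul_sub, one_mul, mul_one, smul_mul_assoc, mul_smul_comm, PP_sq]
    module
  have hQQ : ∀ s t : ℂ, s + t + s * t * Fintype.card I = 0 →
      (1 + s • QQ A I) * (1 + t • QQ A I) = 1 := by
    intro s t hst
    simp only [add_mul, mul_add, one_mul, mul_one, smul_mul_assoc, mul_smul_comm, QQ_sq]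
    have : (1 + s • QQ A I + (t • QQ A I + t • s • (Fintype.card I : ℂ) • QQ A I))
      = 1 + (s + t + s * t * Fintype.card I) • QQ A I := by module
    first
      | rw [this, hst, zero_smul, add_zero]
      | (trans 1 + (s + t + s * t * Fintype.card I) • QQ A I
         · module
         · rw [hst, zero_smul, add_zero])
  have hbc : b + c + b * c * Fintype.card I = 0 := by
    rw [hc]; field_simp; ring
  have hcb : c + b + c * b * Fintype.card I = 0 := by
    rw [← hbc]; ring
  let uP : (Matrix (I × I) (I × I) A)ˣ :=
    ⟨1 - a • PP A I, (1 - a ^ 2)⁻¹ • (1 - (-a) • PP A I), by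
      rw [mul_smul_comm, hPP, smul_smul, inv_mul_cancel₀ ha, one_smul], by
      have := hPP (-a)
      rw [neg_neg, neg_sq] at this
      rw [smul_mul_assoc, this, smul_smul, inv_mul_cancel₀ ha, one_smul]⟩
  let uQ : (Matrix (I × I) (I × I) A)ˣ :=
    ⟨1 + b • QQ A I, 1 + c • QQ A I, hQQ _ _ hbc, hQQ _ _ hcb⟩
  let uX : (Matrix (I × I) (I × I) A)ˣ :=
    ⟨K1 X, K1 X', by rw [K1_mul, hX, K1_one], by rw [K1_mul, hX', K1_one]⟩
  let uY : (Matrix (I × I) (I × I) A)ˣ :=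
    ⟨K2 Y, K2 Y', by rw [K2_mul, hY, K2_one], by rw [K2_mul, hY', K2_one]⟩
  have hu : uP * uX * uQ * uY = uY * uQ * uX * uP := Units.ext h
  have hu2 : uP⁻¹ * uX⁻¹ * uQ⁻¹ * uY⁻¹ = uY⁻¹ * uQ⁻¹ * uX⁻¹ * uP⁻¹ := by
    have := congrArg (fun x => x⁻¹) hu
    simp only [mul_inv_rev, ← mul_assoc] at this
    exact this.symm
  have h3 : ((1 - a ^ 2)⁻¹ • (1 - (-a) • PP A I)) * K1 X' * (1 + c • QQ A I) * K2 Y'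
      = K2 Y' * (1 + c • QQ A I) * K1 X' * ((1 - a ^ 2)⁻¹ • (1 - (-a) • PP A I)) :=
    congrArg Units.val hu2
  simp only [smul_mul_assoc, mul_smul_comm] at h3
  exact (smul_right_injective _ (inv_ne_zero ha)) h3

/-- The Schur complement is inverse to the corresponding block of the inverse. -/
lemma schur {z : I} (M L : Matrix I I A) (d : A) (hML : M * L = 1) (hLM : L * M = 1)
    (hd : d * M z z = 1) (hd' : M z z * d = 1) :
    (Matrix.of fun a b : {i : I // i ≠ z} => M a b - M a z * d * M z b)
        * L.submatrix Subtype.val Subtype.val = 1 ∧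
    L.submatrix Subtype.val Subtype.val
      * (Matrix.of fun a b : {i : I // i ≠ z} => M a b - M a z * d * M z b) = 1 := by
  have split : ∀ f : I → A, ∑ b : {i : I // i ≠ z}, f b = (∑ b, f b) - f z := by
    intro f
    rw [← Fintype.sum_subtype_add_sum_subtype (fun i => i ≠ z) f]
    have : ∑ i : {i : I // ¬ i ≠ z}, f i = f z := by
      have h1 : ∀ i : {i : I // ¬ i ≠ z}, i = ⟨z, by simp⟩ := by
        rintro ⟨i, hi⟩; simpa using hi
      rw [Fintype.sum_eq_single (⟨z, by simp⟩ : {i : I // ¬ i ≠ z})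
        (fun i hi => absurd (h1 i) hi)]
    rw [this]; abel
  have eML : ∀ x y, ∑ b, M x b * L b y = if x = y then 1 else 0 := fun x y => by
    rw [← Matrix.mul_apply, hML, Matrix.one_apply]
  have eLM : ∀ x y, ∑ b, L x b * M b y = if x = y then 1 else 0 := fun x y => by
    rw [← Matrix.mul_apply, hLM, Matrix.one_apply]
  constructor
  · ext ⟨x, hx⟩ ⟨y, hy⟩
    simp only [Matrix.mul_apply, Matrix.of_apply, Matrix.submatrix_apply, Matrix.one_apply,
      Subtype.mk.injEq]
    rw [split (fun b => (M x b - M x z * d * M z b) * L b y)]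
    simp only [sub_mul, Finset.sum_sub_distrib, mul_assoc, ← Finset.mul_sum, eML, if_neg hy.symm]
    rw [← mul_assoc d, hd]
    simp
  · ext ⟨x, hx⟩ ⟨y, hy⟩
    simp only [Matrix.mul_apply, Matrix.of_apply, Matrix.submatrix_apply, Matrix.one_apply,
      Subtype.mk.injEq]
    rw [split (fun b => L x b * (M b y - M b z * d * M z y))]
    simp only [mul_sub, Finset.sum_sub_distrib, ← mul_assoc, ← Finset.sum_mul, eLM, if_neg hx]
    rw [mul_assoc (L x z) (M z z), hd']
    simp

end CrossedRefl

/-- First nesting step of Theorem 4.1: the shifted nested crossed K-matrix satisfies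
the crossed reflection relation of size N−1. -/
theorem stmt_8 {A : Type*} [Ring A] [Algebra ℂ A]
    (N : ℕ) (hN : 2 ≤ N)
    (K : ℂ → Fin N → Fin N → A)
    (hrel : ∀ u' v' : ℂ, u' ≠ v' → u' ≠ -v' → ∀ i j k l : Fin N,
      K u' i j * K v' k l - K v' k l * K u' i j =
        (u' - v')⁻¹ • (K u' k j * K v' i l - K v' k j * K u' i l)
        - (u' + v')⁻¹ • (K u' i k * K v' j l - K v' k i * K u' l j)
        + (u' ^ 2 - v' ^ 2)⁻¹ • (K u' k i * K v' j l - K v' k i * K u' j l))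
    (hM : ∀ w : ℂ, IsUnit (Matrix.of (fun i j => K w i j) : Matrix (Fin N) (Fin N) A))
    (Kinv : ℂ → A)
    (hKinv : ∀ w : ℂ, Kinv w * K w ⟨0, by omega⟩ ⟨0, by omega⟩ = 1 ∧
      K w ⟨0, by omega⟩ ⟨0, by omega⟩ * Kinv w = 1)
    (u v : ℂ)
    (huv : ∀ m : ℤ, |m| ≤ 2 * (N : ℤ) + 4 →
      2 * (u - v) ≠ (m : ℂ) ∧ 2 * (u + v) ≠ (m : ℂ)) :
    ∀ i j k l : Fin N,
      i ≠ (⟨0, by omega⟩ : Fin N) → j ≠ (⟨0, by omega⟩ : Fin N) →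
      k ≠ (⟨0, by omega⟩ : Fin N) → l ≠ (⟨0, by omega⟩ : Fin N) →
      shiftedNestedK N hN K Kinv u i j * shiftedNestedK N hN K Kinv v k l
          - shiftedNestedK N hN K Kinv v k l * shiftedNestedK N hN K Kinv u i j =
        (u - v)⁻¹ • (shiftedNestedK N hN K Kinv u k j * shiftedNestedK N hN K Kinv v i l
            - shiftedNestedK N hN K Kinv v k j * shiftedNestedK N hN K Kinv u i l)
        - (u + v)⁻¹ • (shiftedNestedK N hN K Kinv u i k * shiftedNestedK N hN K Kinv v j l
            - shiftedNestedK N hN K Kinv v k i * shiftedNestedK N hN K Kinv u l j)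
        + (u ^ 2 - v ^ 2)⁻¹ • (shiftedNestedK N hN K Kinv u k i * shiftedNestedK N hN K Kinv v j l
            - shiftedNestedK N hN K Kinv v k i * shiftedNestedK N hN K Kinv u j l) := by
  intro i j k l hi hj hk hl
  have hne : ∀ m : ℤ, |m| ≤ 2 * (N : ℤ) + 4 → 2 * (u - v) - m ≠ 0 ∧ 2 * (u + v) - m ≠ 0 :=
    fun m hm => ⟨sub_ne_zero.2 (huv m hm).1, sub_ne_zero.2 (huv m hm).2⟩
  have h0 := hne 0 (by simp; omega)
  have h2 := hne 2 (by rw [abs_of_pos] <;> omega)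
  have h2' := hne (-2) (by rw [abs_neg, abs_of_pos] <;> omega)
  have hN2 := hne (-(2 * ((N : ℤ) - 1))) (by rw [abs_neg, abs_of_nonneg] <;> omega)
  push_cast at h0 h2 h2' hN2
  have d1 : u - v ≠ 0 := fun h => h0.1 (by linear_combination 2 * h)
  have d2 : u + v ≠ 0 := fun h => h0.2 (by linear_combination 2 * h)
  have d3 : u - v - 1 ≠ 0 := fun h => h2.1 (by linear_combination 2 * h)
  have d4 : u - v + 1 ≠ 0 := fun h => h2'.1 (by linear_combination 2 * h)
  have d5 : u + v - 1 ≠ 0 := fun h => h2.2 (by linear_combination 2 * h)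
  have d6 : u + v - 1 + N ≠ 0 := fun h => hN2.2 (by linear_combination 2 * h)
  have ha : 1 - ((u - v)⁻¹) ^ 2 ≠ 0 := by
    have : 1 - ((u - v)⁻¹) ^ 2 = (u - v - 1) * (u - v + 1) / (u - v) ^ 2 := by
      field_simp; ring
    rw [this]
    exact div_ne_zero (mul_ne_zero d3 d4) (pow_ne_zero _ d1)
  let z : Fin N := ⟨0, by omega⟩
  let M : ℂ → Matrix (Fin N) (Fin N) A := fun w => Matrix.of (fun i j => K w i j)
  have hrel1 : CrossedRefl.Rel (M (u - 1 / 2)) (M (v - 1 / 2)) (u - v)⁻¹ (u + v - 1)⁻¹ := by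
    intro i j k l
    have := hrel (u - 1 / 2) (v - 1 / 2) (fun h => d1 (by linear_combination h))
      (fun h => d5 (by linear_combination h)) i j k l
    have e1 : u - 1 / 2 - (v - 1 / 2) = u - v := by ring
    have e2 : u - 1 / 2 + (v - 1 / 2) = u + v - 1 := by ring
    have e3 : ((u - 1 / 2) ^ 2 - (v - 1 / 2) ^ 2)⁻¹ = (u - v)⁻¹ * (u + v - 1)⁻¹ := by
      rw [← mul_inv]; congr 1; ring
    rw [e1, e2, e3] at this
    exact this
  obtain ⟨X, hX⟩ := hM (u - 1 / 2)
  obtain ⟨Y, hY⟩ := hM (v - 1 / 2)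
  change X.val = M _ at hX
  change Y.val = M _ at hY
  have x1 : M (u - 1 / 2) * X⁻¹.val = 1 := by rw [← hX, Units.mul_inv]
  have x2 : X⁻¹.val * M (u - 1 / 2) = 1 := by rw [← hX, Units.inv_mul]
  have y1 : M (v - 1 / 2) * Y⁻¹.val = 1 := by rw [← hY, Units.mul_inv]
  have y2 : Y⁻¹.val * M (v - 1 / 2) = 1 := by rw [← hY, Units.inv_mul]
  have hb1 : 1 + (u + v - 1)⁻¹ * (N : ℂ) ≠ 0 := by
    have : 1 + (u + v - 1)⁻¹ * (N : ℂ) = (u + v - 1 + N) / (u + v - 1) := by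
      field_simp
    rw [this]
    exact div_ne_zero d6 d5
  have hrel2 := CrossedRefl.rel_inv _ _ _ _ _ _ hrel1 x1 x2 y1 y2 ha
    (by rw [Fintype.card_fin]; exact hb1)
  rw [Fintype.card_fin] at hrel2
  have eb : -((u + v - 1)⁻¹ / (1 + (u + v - 1)⁻¹ * (N : ℂ))) = -(u + v - 1 + N)⁻¹ := by
    field_simp
  rw [eb] at hrel2
  obtain ⟨sx1, sx2⟩ := CrossedRefl.schur (z := z) (M (u - 1 / 2)) X⁻¹.val (Kinv (u - 1 / 2)) x1 x2
    (hKinv _).1 (hKinv _).2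
  obtain ⟨sy1, sy2⟩ := CrossedRefl.schur (z := z) (M (v - 1 / 2)) Y⁻¹.val (Kinv (v - 1 / 2)) y1 y2
    (hKinv _).1 (hKinv _).2
  have hrel3 : CrossedRefl.Rel
      (X⁻¹.val.submatrix (Subtype.val : {i : Fin N // i ≠ z} → Fin N) Subtype.val)
      (Y⁻¹.val.submatrix (Subtype.val : {i : Fin N // i ≠ z} → Fin N) Subtype.val)
      (-(u - v)⁻¹) (-(u + v - 1 + N)⁻¹) :=
    fun i j k l => hrel2 i j k l
  have hcard : (Fintype.card {i : Fin N // i ≠ z} : ℂ) = (N : ℂ) - 1 := by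
    rw [Fintype.card_subtype_compl, Fintype.card_subtype_eq, Fintype.card_fin,
      Nat.cast_sub (by omega), Nat.cast_one]
  have hb2e : 1 + -(u + v - 1 + N)⁻¹ * ((N : ℂ) - 1) = (u + v) / (u + v - 1 + N) := by
    field_simp; ring
  have hb2 : 1 + -(u + v - 1 + N)⁻¹ * ((N : ℂ) - 1) ≠ 0 := by
    rw [hb2e]; exact div_ne_zero d2 d6
  have hrel4 := CrossedRefl.rel_inv _ _ _ _ _ _ hrel3 sx2 sx1 sy2 sy1
    (by rw [neg_sq]; exact ha) (by rw [hcard]; exact hb2)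
  rw [hcard, hb2e, neg_neg] at hrel4
  have eb2 : -(-(u + v - 1 + (N : ℂ))⁻¹ / ((u + v) / (u + v - 1 + N))) = (u + v)⁻¹ := by
    field_simp
  rw [eb2] at hrel4
  have e3 : (u ^ 2 - v ^ 2)⁻¹ = (u - v)⁻¹ * (u + v)⁻¹ := by
    rw [← mul_inv]; congr 1; ring
  rw [e3]
  exact hrel4 ⟨i, hi⟩ ⟨j, hj⟩ ⟨k, hk⟩ ⟨l, hl⟩
end

section
/- Let A be a unital associative ℂ-algebra and N ≥ 2. Suppose K_{i,j} : ℂ → A (1 ≤ i,j ≤ N) satisfies the crossed reflection relation at every pair of parameters (u', v') with u' ≠ ±v', that the matrix K(w) is invertible in M_N(A) for every w ∈ ℂ, and that K_{1,1}(w) is invertible in A for every w ∈ ℂ. Define the G-operators G⁽¹⁾(w) := K_{1,1}(w) and G⁽²⁾(w) := K_{2,2}(w) − K_{2,1}(w)·K_{1,1}(w)⁻¹·K_{1,2}(w). Then for all u, v ∈ ℂ such that neither 2(u−v) nor 2(u+v) is an integer of absolute value at most 2N+6, the G-operators pairwise commute: G⁽¹⁾(u)G⁽¹⁾(v) = G⁽¹⁾(v)G⁽¹⁾(u),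 G⁽¹⁾(u)G⁽²⁾(v) = G⁽²⁾(v)G⁽¹⁾(u), and G⁽²⁾(u)G⁽²⁾(v) = G⁽²⁾(v)G⁽²⁾(u). -/
section Helpers

variable {A : Type*} [Ring A] [Algebra ℂ A]

/-- Cancel a nonzero scalar in an equation. -/
theorem smul_cancel_aux {r : ℂ} (hr : r ≠ 0) {z z' : A} (h : r • (z - z') = 0) : z = z' := by
  rcases smul_eq_zero.mp h with h | h
  · exact absurd h hr
  · exact sub_eq_zero.mp h

/-- The (1,1) entries commute. -/
theorem comm_one_aux (a e : A) (p q : ℂ) (hp : 1 - p ≠ 0) (hq : 1 + q ≠ 0)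
    (h : a * e - e * a = p • (a * e - e * a) - q • (a * e - e * a)
      + (p * q) • (a * e - e * a)) : a * e = e * a := by
  refine smul_cancel_aux (mul_ne_zero hp hq) ?_
  linear_combination (norm := (simp only [mul_add, add_mul, mul_sub, sub_mul, smul_mul_assoc, mul_smul_comm, mul_assoc]; module)) h

/-- The Schur complement commutes with the (1,1) entry at the other parameter. -/
theorem comm_schur_aux (a e x y w t G H : A) (p q : ℂ)
    (h1111 : a * e - e * a =
      p • (a * e - e * a)
      - q • (a * e - e * a)
      + (p * q) • (a * e - e * a))
    (h1112 : a * (e * t) - (e * t) * a =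
      p • (a * (e * t) - e * (a * w))
      - q • (a * (e * t) - e * (x * a))
      + (p * q) • (a * (e * t) - e * (a * w)))
    (h1121 : a * (y * e) - (y * e) * a =
      p • ((x * a) * e - (y * e) * a)
      - q • ((a * w) * e - (y * e) * a)
      + (p * q) • ((x * a) * e - (y * e) * a))
    (h1122 : a * (H + y * e * t) - (H + y * e * t) * a =
      p • ((x * a) * (e * t) - (y * e) * (a * w))
      - q • ((a * w) * (e * t) - (y * e) * (x * a))
      + (p * q) • ((x * a) * (e * t) - (y * e) * (a * w))) :
    a * H = H * a := by
  linear_combination (norm := (simp only [mul_add, add_mul, mul_sub, sub_mul, smul_mul_assoc, mul_smul_comm, mul_assoc]; module)) h1122 - y * h1112 - h1121 * t + y * h1111 * t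

/-- Exchange relation of the lower triangular coordinates. -/
theorem lower_aux (a e x y w t G H : A) (p q : ℂ) (hp : 1 - p ≠ 0) (hae : a * e = e * a)
    (h1121 : a * (y * e) - (y * e) * a =
      p • ((x * a) * e - (y * e) * a)
      - q • ((a * w) * e - (y * e) * a)
      + (p * q) • ((x * a) * e - (y * e) * a))
    (h2121 : (x * a) * (y * e) - (y * e) * (x * a) =
      p • ((x * a) * (y * e) - (y * e) * (x * a))
      - q • ((G + x * a * w) * e - (H + y * e * t) * a)
      + (p * q) • ((G + x * a * w) * e - (H + y * e * t) * a))
    (k1121 : e * (x * a) - (x * a) * e =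
      (-p) • ((y * e) * a - (x * a) * e)
      - q • ((e * t) * a - (x * a) * e)
      + ((-p) * q) • ((y * e) * a - (x * a) * e)) :
    ((1 + q) • (x * y - y * x + p • ((x - y) * (x - y)))) * (a * e) = q • (H * a - G * e) := by
  refine smul_cancel_aux hp ?_
  have h1 := congrArg (fun z => (x * y) * z) hae
  have h2 := congrArg (fun z => (y * y) * z) hae
  linear_combination (norm := (simp only [mul_add, add_mul, mul_sub, sub_mul, smul_mul_assoc, mul_smul_comm, mul_assoc]; module)) h2121 - (1 - p) • (x * h1121) + (1 - p) • (y * k1121) + ((1 - p) * (1 - p) * (1 + q)) • h1 + ((1 - p) * p * (1 + q)) • h2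

/-- Exchange relation of the upper triangular coordinates. -/
theorem upper_aux (a e x y w t G H : A) (p q : ℂ) (hp : 1 - p ≠ 0) (hae : a * e = e * a)
    (h1112 : a * (e * t) - (e * t) * a =
      p • (a * (e * t) - e * (a * w))
      - q • (a * (e * t) - e * (x * a))
      + (p * q) • (a * (e * t) - e * (a * w)))
    (h1212 : (a * w) * (e * t) - (e * t) * (a * w) =
      p • ((a * w) * (e * t) - (e * t) * (a * w))
      - q • (a * (H + y * e * t) - e * (G + x * a * w))
      + (p * q) • (a * (H + y * e * t) - e * (G + x * a * w)))
    (k1112 : e * (a * w) - (a * w) * e =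
      (-p) • (e * (a * w) - a * (e * t))
      - q • (e * (a * w) - a * (y * e))
      + ((-p) * q) • (e * (a * w) - a * (e * t))) :
    (e * a) * ((1 + q) • (t * w - w * t + p • ((w - t) * (w - t)))) = q • (a * H - e * G) := by
  refine smul_cancel_aux hp ?_
  have h1 := congrArg (fun z => z * (t * w)) hae
  have h2 := congrArg (fun z => z * (t * t)) hae
  linear_combination (norm := (simp only [mul_add, add_mul, mul_sub, sub_mul, smul_mul_assoc, mul_smul_comm, mul_assoc]; module)) (1 - p) • (h1112 * w) - (1 - p) • (k1112 * t) - h1212 - ((1 - p) * (1 - p) * (1 + q)) • h1 - ((1 - p) * p * (1 + q)) • h2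

/-- Two Schur complements at different parameters commute. -/
theorem comm_two_aux (a e x y w t G H : A) (i' : A) (p q : ℂ) (hp : 1 - p ≠ 0)
    (hq : 1 + q ≠ 0) (hq2 : 1 + 2 * q ≠ 0) (hi1 : i' * e = 1) (hi2 : e * i' = 1)
    (h1111 : a * e - e * a =
      p • (a * e - e * a)
      - q • (a * e - e * a)
      + (p * q) • (a * e - e * a))
    (h1112 : a * (e * t) - (e * t) * a =
      p • (a * (e * t) - e * (a * w))
      - q • (a * (e * t) - e * (x * a))
      + (p * q) • (a * (e * t) - e * (a * w)))
    (h1121 : a * (y * e) - (y * e) * a =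
      p • ((x * a) * e - (y * e) * a)
      - q • ((a * w) * e - (y * e) * a)
      + (p * q) • ((x * a) * e - (y * e) * a))
    (h1122 : a * (H + y * e * t) - (H + y * e * t) * a =
      p • ((x * a) * (e * t) - (y * e) * (a * w))
      - q • ((a * w) * (e * t) - (y * e) * (x * a))
      + (p * q) • ((x * a) * (e * t) - (y * e) * (a * w)))
    (h1211 : (a * w) * e - e * (a * w) =
      p • ((a * w) * e - (e * t) * a)
      - q • (a * (y * e) - e * (a * w))
      + (p * q) • (a * (y * e) - e * (x * a)))
    (h1212 : (a * w) * (e * t) - (e * t) * (a * w) =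
      p • ((a * w) * (e * t) - (e * t) * (a * w))
      - q • (a * (H + y * e * t) - e * (G + x * a * w))
      + (p * q) • (a * (H + y * e * t) - e * (G + x * a * w)))
    (h1221 : (a * w) * (y * e) - (y * e) * (a * w) =
      p • ((G + x * a * w) * e - (H + y * e * t) * a)
      - q • ((a * w) * (y * e) - (y * e) * (a * w))
      + (p * q) • ((x * a) * (y * e) - (y * e) * (x * a)))
    (h1222 : (a * w) * (H + y * e * t) - (H + y * e * t) * (a * w) =
      p • ((G + x * a * w) * (e * t) - (H + y * e * t) * (a * w))
      - q • ((a * w) * (H + y * e * t) - (y * e) * (G + x * a * w))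
      + (p * q) • ((x * a) * (H + y * e * t) - (y * e) * (G + x * a * w)))
    (h2111 : (x * a) * e - e * (x * a) =
      p • (a * (y * e) - e * (x * a))
      - q • ((x * a) * e - (e * t) * a)
      + (p * q) • ((a * w) * e - (e * t) * a))
    (h2112 : (x * a) * (e * t) - (e * t) * (x * a) =
      p • (a * (H + y * e * t) - e * (G + x * a * w))
      - q • ((x * a) * (e * t) - (e * t) * (x * a))
      + (p * q) • ((a * w) * (e * t) - (e * t) * (a * w)))
    (h2121 : (x * a) * (y * e) - (y * e) * (x * a) =
      p • ((x * a) * (y * e) - (y * e) * (x * a))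
      - q • ((G + x * a * w) * e - (H + y * e * t) * a)
      + (p * q) • ((G + x * a * w) * e - (H + y * e * t) * a))
    (h2122 : (x * a) * (H + y * e * t) - (H + y * e * t) * (x * a) =
      p • ((x * a) * (H + y * e * t) - (y * e) * (G + x * a * w))
      - q • ((G + x * a * w) * (e * t) - (H + y * e * t) * (x * a))
      + (p * q) • ((G + x * a * w) * (e * t) - (H + y * e * t) * (a * w)))
    (h2211 : (G + x * a * w) * e - e * (G + x * a * w) =
      p • ((a * w) * (y * e) - (e * t) * (x * a))
      - q • ((x * a) * (y * e) - (e * t) * (a * w))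
      + (p * q) • ((a * w) * (y * e) - (e * t) * (x * a)))
    (h2212 : (G + x * a * w) * (e * t) - (e * t) * (G + x * a * w) =
      p • ((a * w) * (H + y * e * t) - (e * t) * (G + x * a * w))
      - q • ((x * a) * (H + y * e * t) - (e * t) * (G + x * a * w))
      + (p * q) • ((a * w) * (H + y * e * t) - (e * t) * (G + x * a * w)))
    (h2221 : (G + x * a * w) * (y * e) - (y * e) * (G + x * a * w) =
      p • ((G + x * a * w) * (y * e) - (H + y * e * t) * (x * a))
      - q • ((G + x * a * w) * (y * e) - (H + y * e * t) * (a * w))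
      + (p * q) • ((G + x * a * w) * (y * e) - (H + y * e * t) * (x * a)))
    (h2222 : (G + x * a * w) * (H + y * e * t) - (H + y * e * t) * (G + x * a * w) =
      p • ((G + x * a * w) * (H + y * e * t) - (H + y * e * t) * (G + x * a * w))
      - q • ((G + x * a * w) * (H + y * e * t) - (H + y * e * t) * (G + x * a * w))
      + (p * q) • ((G + x * a * w) * (H + y * e * t) - (H + y * e * t) * (G + x * a * w)))
    (k1121 : e * (x * a) - (x * a) * e =
      (-p) • ((y * e) * a - (x * a) * e)
      - q • ((e * t) * a - (x * a) * e)
      + ((-p) * q) • ((y * e) * a - (x * a) * e))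
    (k1112 : e * (a * w) - (a * w) * e =
      (-p) • (e * (a * w) - a * (e * t))
      - q • (e * (a * w) - a * (y * e))
      + ((-p) * q) • (e * (a * w) - a * (e * t))) :
    G * H = H * G := by
  have hae : a * e = e * a := comm_one_aux a e p q hp hq h1111
  have haH : a * H = H * a := comm_schur_aux a e x y w t G H p q h1111 h1112 h1121 h1122
  have hlow := lower_aux a e x y w t G H p q hp hae h1121 h2121 k1121
  have hupp := upper_aux a e x y w t G H p q hp hae h1112 h1212 k1112
  have hai : a * i' = i' * a := by
    calc a * i' = (i' * e) * (a * i') := by rw [hi1, one_mul]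
      _ = i' * (e * a) * i' := by simp only [mul_assoc]
      _ = i' * (a * e) * i' := by rw [hae]
      _ = i' * a * (e * i') := by simp only [mul_assoc]
      _ = i' * a := by rw [hi2, mul_one]
  have hlow' : ((1 + q) • (x * y - y * x + p • ((x - y) * (x - y)))) * a
      = q • (H * a * i' - G) := by
    have h := congrArg (fun z => z * i') hlow
    simpa only [mul_assoc, hi2, mul_one, smul_mul_assoc, sub_mul] using h
  have hupp' : a * ((1 + q) • (t * w - w * t + p • ((w - t) * (w - t))))
      = q • (i' * a * H - G) := by
    have h := congrArg (fun z => i' * z) hupp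
    have hc : ∀ z : A, i' * (e * z) = z := fun z => by rw [← mul_assoc, hi1, one_mul]
    simpa only [mul_assoc, hc, mul_smul_comm, mul_sub] using h
  have e21 : ((1 - p) • x + p • y) * a * H = H * ((1 + q) • (x * a) - (q * (1 - p)) • (a * t) - (p * q) • (a * w)) := by
    linear_combination (norm := (simp only [mul_add, add_mul, mul_sub, sub_mul, smul_mul_assoc, mul_smul_comm, mul_assoc]; module)) h2122 - y * h2112 - h2121 * t + y * h2111 * t
  have e12 : ((1 + q) • (a * w) - (q * (1 - p)) • (y * a) - (p * q) • (x * a)) * H = H * (a * ((1 - p) • w + p • t)) := by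
    linear_combination (norm := (simp only [mul_add, add_mul, mul_sub, sub_mul, smul_mul_assoc, mul_smul_comm, mul_assoc]; module)) h1222 - y * h1212 - h1221 * t + y * h1211 * t
  have e22 : ((1 + q) • ((1 - p) • (G + x * a * w) + p • (y * a * w)) - q • (y * x * a)) * H = H * ((1 + q) • ((1 - p) • (G + x * a * w) + p • (x * a * t)) - q • (a * w * t)) := by
    linear_combination (norm := (simp only [mul_add, add_mul, mul_sub, sub_mul, smul_mul_assoc, mul_smul_comm, mul_assoc]; module)) h2222 - y * h2212 - h2221 * t + y * h2211 * t
  have hS : ((1 - p) • ((1 + q) • G + q • ((x * y - y * x + p • ((x - y) * (x - y))) * a))) * H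
      = H * ((1 - p) • ((1 + q) • G + q • (a * (t * w - w * t + p • ((w - t) * (w - t)))))) := by
    linear_combination (norm := (simp only [mul_add, add_mul, mul_sub, sub_mul, smul_mul_assoc, mul_smul_comm, mul_assoc]; module)) e22 - ((1 - p) • x + p • y) * e12 - e21 * ((1 - p) • w + p • t) + ((1 - p) • x + p • y) * haH * ((1 - p) • w + p • t)
  refine smul_cancel_aux (mul_ne_zero hp hq2) ?_
  have hH : H * (a * i') * H = H * (i' * a) * H := by rw [hai]
  linear_combination (norm := (simp only [mul_add, add_mul, mul_sub, sub_mul, smul_mul_assoc, mul_smul_comm, mul_assoc]; module)) (1 + q) • hS - ((1 - p) * q) • (hlow' * H) + ((1 - p) * q) • (H * hupp') - ((1 - p) * q * q) • hH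

end Helpers


/-- The first G-operator: `G⁽¹⁾(w) = K_{1,1}(w)`. -/
noncomputable def Gone {A : Type*} [Ring A] (N : ℕ) (hN : 2 ≤ N)
    (K : ℂ → Fin N → Fin N → A) (w : ℂ) : A :=
  K w ⟨0, by omega⟩ ⟨0, by omega⟩

/-- The second G-operator: `G⁽²⁾(w) = K_{2,2}(w) − K_{2,1}(w) K_{1,1}(w)⁻¹ K_{1,2}(w)`. -/
noncomputable def Gtwo {A : Type*} [Ring A] (N : ℕ) (hN : 2 ≤ N)
    (K : ℂ → Fin N → Fin N → A) (Kinv : ℂ → A) (w : ℂ) : A :=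
  K w ⟨1, by omega⟩ ⟨1, by omega⟩ -
    K w ⟨1, by omega⟩ ⟨0, by omega⟩ * Kinv w * K w ⟨0, by omega⟩ ⟨1, by omega⟩

/-- Corollary to Theorem 4.1 for k, l ∈ {1,2}: the G-operators of a crossed K-matrix
pairwise commute. -/
theorem stmt_9 {A : Type*} [Ring A] [Algebra ℂ A]
    (N : ℕ) (hN : 2 ≤ N)
    (K : ℂ → Fin N → Fin N → A)
    (hrel : ∀ u' v' : ℂ, u' ≠ v' → u' ≠ -v' → ∀ i j k l : Fin N,
      K u' i j * K v' k l - K v' k l * K u' i j =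
        (u' - v')⁻¹ • (K u' k j * K v' i l - K v' k j * K u' i l)
        - (u' + v')⁻¹ • (K u' i k * K v' j l - K v' k i * K u' l j)
        + (u' ^ 2 - v' ^ 2)⁻¹ • (K u' k i * K v' j l - K v' k i * K u' j l))
    (hM : ∀ w : ℂ, IsUnit (Matrix.of (fun i j => K w i j) : Matrix (Fin N) (Fin N) A))
    (Kinv : ℂ → A)
    (hKinv : ∀ w : ℂ, Kinv w * K w ⟨0, by omega⟩ ⟨0, by omega⟩ = 1 ∧
      K w ⟨0, by omega⟩ ⟨0, by omega⟩ * Kinv w = 1)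
    (u v : ℂ)
    (huv : ∀ m : ℤ, |m| ≤ 2 * (N : ℤ) + 6 →
      2 * (u - v) ≠ (m : ℂ) ∧ 2 * (u + v) ≠ (m : ℂ)) :
    Gone N hN K u * Gone N hN K v = Gone N hN K v * Gone N hN K u ∧
    Gone N hN K u * Gtwo N hN K Kinv v = Gtwo N hN K Kinv v * Gone N hN K u ∧
    Gtwo N hN K Kinv u * Gtwo N hN K Kinv v = Gtwo N hN K Kinv v * Gtwo N hN K Kinv u := by
  have hm := fun (m : ℤ) (h : |m| ≤ 10) => huv m (h.trans (by
    have : (2 : ℤ) ≤ (N : ℤ) := by exact_mod_cast hN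
    linarith))
  have n0 := hm 0 (by norm_num)
  have n2 := hm 2 (by norm_num)
  have nn2 := hm (-2) (by norm_num)
  have nn4 := hm (-4) (by norm_num)
  have d0 : u - v ≠ 0 := fun h => n0.1 (by rw [h]; norm_num)
  have s0 : u + v ≠ 0 := fun h => n0.2 (by rw [h]; norm_num)
  have d1 : u - v ≠ 1 := fun h => n2.1 (by rw [h]; norm_num)
  have dm1 : u - v ≠ -1 := fun h => nn2.1 (by rw [h]; norm_num)
  have s1 : u + v ≠ -1 := fun h => nn2.2 (by rw [h]; norm_num)
  have s2 : u + v ≠ -2 := fun h => nn4.2 (by rw [h]; norm_num)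
  have hp : 1 - (u - v)⁻¹ ≠ 0 := by
    intro h
    apply d1
    field_simp at h
    linear_combination h
  have hq : 1 + (u + v)⁻¹ ≠ 0 := by
    intro h
    apply s1
    field_simp at h
    linear_combination h
  have hq2 : 1 + 2 * (u + v)⁻¹ ≠ 0 := by
    intro h
    apply s2
    field_simp at h
    linear_combination h
  have huv1 : u ≠ v := fun h => d0 (by rw [h, sub_self])
  have huv2 : u ≠ -v := fun h => s0 (by rw [h]; ring)
  have R := hrel u v huv1 huv2
  have R' := hrel v u huv1.symm (fun h => s0 (by rw [h]; ring))
  have c1 : (u ^ 2 - v ^ 2)⁻¹ = (u - v)⁻¹ * (u + v)⁻¹ := by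
    rw [← mul_inv]; congr 1; ring
  have c2 : (v ^ 2 - u ^ 2)⁻¹ = (-(u - v)⁻¹) * (u + v)⁻¹ := by
    rw [← inv_neg, ← mul_inv]; congr 1; ring
  have c3 : (v - u)⁻¹ = -(u - v)⁻¹ := by
    rw [← inv_neg]; congr 1; ring
  rw [c1] at R
  rw [c2, c3, add_comm v u] at R'
  obtain ⟨hu1, hu2⟩ := hKinv u
  obtain ⟨hv1, hv2⟩ := hKinv v
  unfold Gone Gtwo
  generalize (u - v)⁻¹ = p at *
  generalize (u + v)⁻¹ = q at *
  generalize (⟨0, by omega⟩ : Fin N) = n1 at *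
  generalize (⟨1, by omega⟩ : Fin N) = n2' at *
  have par : ∀ w : ℂ, Kinv w * K w n1 n1 = 1 → K w n1 n1 * Kinv w = 1 →
      ∃ x y G : A, K w n2' n1 = x * K w n1 n1 ∧ K w n1 n2' = K w n1 n1 * y ∧
        K w n2' n2' = G + x * K w n1 n1 * y ∧
        K w n2' n2' - K w n2' n1 * Kinv w * K w n1 n2' = G := by
    intro w h1 h2
    refine ⟨K w n2' n1 * Kinv w, Kinv w * K w n1 n2',
      K w n2' n2' - K w n2' n1 * Kinv w * K w n1 n2', ?_, ?_, ?_, rfl⟩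
    · rw [mul_assoc, h1, mul_one]
    · rw [← mul_assoc, h2, one_mul]
    · rw [mul_assoc (K w n2' n1) (Kinv w) (K w n1 n1), h1, mul_one, ← mul_assoc]
      abel
  obtain ⟨x, w, G, hc, hb, hd, hG⟩ := par u hu1 hu2
  obtain ⟨y, t, H, hc', hb', hd', hH⟩ := par v hv1 hv2
  rw [hG, hH]
  have h1111 := R n1 n1 n1 n1
  have h1112 := R n1 n1 n1 n2'
  have h1121 := R n1 n1 n2' n1
  have h1122 := R n1 n1 n2' n2'
  have h1211 := R n1 n2' n1 n1
  have h1212 := R n1 n2' n1 n2'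
  have h1221 := R n1 n2' n2' n1
  have h1222 := R n1 n2' n2' n2'
  have h2111 := R n2' n1 n1 n1
  have h2112 := R n2' n1 n1 n2'
  have h2121 := R n2' n1 n2' n1
  have h2122 := R n2' n1 n2' n2'
  have h2211 := R n2' n2' n1 n1
  have h2212 := R n2' n2' n1 n2'
  have h2221 := R n2' n2' n2' n1
  have h2222 := R n2' n2' n2' n2'
  have k1112 := R' n1 n1 n1 n2'
  have k1121 := R' n1 n1 n2' n1
  simp only [hb, hc, hd, hb', hc', hd'] at h1111 h1112 h1121 h1122 h1211 h1212 h1221 h1222 h2111 h2112 h2121 h2122 h2211 h2212 h2221 h2222 k1112 k1121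
  refine ⟨comm_one_aux _ _ p q hp hq h1111,
    comm_schur_aux _ _ x y w t G H p q h1111 h1112 h1121 h1122,
    comm_two_aux _ _ x y w t G H (Kinv v) p q hp hq hq2 hv1 hv2
      h1111 h1112 h1121 h1122
      h1211 h1212 h1221 h1222
      h2111 h2112 h2121 h2122
      h2211 h2212 h2221 h2222
      k1121 k1112⟩
end
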